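/- arXiv:2302.14380 — 3 statements merged into one kernel-verified Lean document; each statement's English description precedes it below -/
import Mathlib

section
/- Let K ≥ 1. Suppose π, π' : {1,…,K} → ℝ satisfy π_k > 0 and π'_k > 0 for every k, with Σ_{k=1}^K π_k = Σ_{k=1}^K π'_k = 1, and suppose b, b' : {1,…,K} → ℝ are strictly increasing, i.e. b_1 < b_2 < ⋯ < b_K and b'_1 < b'_2 < ⋯ < b'_K. If Σ_{k=1}^K π_k b_k^r = Σ_{k=1}^K π'_k (b'_k)^r for every r = 0, 1, …, 2K−1, then b_k = b'_k and π_k = π'_k for all k = 1,…,K. In other words, the parameters of a K-categorical distribution are uniquely determined by its moments of order up to 2K−1. -/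
/-- A weighted sum of values of a polynomial is a linear combination of moments. -/
theorem sum_mul_eval_eq_sum_coeff_mul {R ι : Type*} [CommRing R] [Fintype ι]
    (w b : ι → R) (p : Polynomial R) :
    ∑ i, w i * p.eval (b i) = ∑ r ∈ p.support, p.coeff r * ∑ i, w i * b i ^ r := by
  simp_rw [Polynomial.eval_eq_sum, Polynomial.sum, Finset.mul_sum]
  rw [Finset.sum_comm]
  exact Finset.sum_congr rfl fun _ _ => Finset.sum_congr rfl fun _ _ => mul_left_comm _ _ _

/-- Equality of moments of order less than `n` extends to polynomials of degree less than `n`. -/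
theorem sum_mul_eval_eq_of_moments_eq {R ι κ : Type*} [CommRing R] [Fintype ι] [Fintype κ]
    {n : ℕ} {w b : ι → R} {w' b' : κ → R}
    (hmom : ∀ r < n, ∑ i, w i * b i ^ r = ∑ j, w' j * b' j ^ r)
    {p : Polynomial R} (hp : p.degree < n) :
    ∑ i, w i * p.eval (b i) = ∑ j, w' j * p.eval (b' j) := by
  rw [sum_mul_eval_eq_sum_coeff_mul, sum_mul_eval_eq_sum_coeff_mul]
  refine Finset.sum_congr rfl fun r hr => ?_
  rw [hmom r]
  exact_mod_cast (Polynomial.le_degree_of_mem_supp r hr).trans_lt hp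

/-- Two weighted families of points in a set with at most `n` elements whose moments of order
less than `n` agree give the same mass to every point of that set. -/
theorem mass_eq_of_moments_eq {F ι κ : Type*} [Field F] [DecidableEq F] [Fintype ι] [Fintype κ]
    {n : ℕ} {w b : ι → F} {w' b' : κ → F} {s : Finset F} (hs : s.card ≤ n)
    (hb : ∀ i, b i ∈ s) (hb' : ∀ j, b' j ∈ s)
    (hmom : ∀ r < n, ∑ i, w i * b i ^ r = ∑ j, w' j * b' j ^ r) {x : F} (hx : x ∈ s) :
    (∑ i, if b i = x then w i else 0) = ∑ j, if b' j = x then w' j else 0 := by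
  have hinj : Set.InjOn (id : F → F) s := Function.injective_id.injOn
  have hdeg : (Lagrange.basis s id x).degree < n := by
    rw [Lagrange.degree_basis hinj hx]
    have := Finset.card_pos.mpr ⟨x, hx⟩
    exact_mod_cast (by omega : s.card - 1 < n)
  have heval {y : F} (hy : y ∈ s) (c : F) :
      c * (Lagrange.basis s id x).eval y = if y = x then c else 0 := by
    split_ifs with h
    · subst h
      have := Lagrange.eval_basis_self hinj hx
      simp_all
    · have := Lagrange.eval_basis_of_ne (v := id) (Ne.symm h) hy
      simp_all
  simpa only [heval (hb _), heval (hb' _)] using sum_mul_eval_eq_of_moments_eq hmom hdeg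

/-- If the masses at each point of a positively weighted injective family agree with those of
another family, then each point of the first family belongs to the second. -/
theorem range_subset_range_of_mass_eq {α ι κ : Type*} [DecidableEq α] [Fintype ι] [Fintype κ]
    {w : ι → ℝ} {b : ι → α} {w' : κ → ℝ} {b' : κ → α} (hw : ∀ i, 0 < w i)
    (hb : Function.Injective b)
    (hmass : ∀ i, (∑ k, if b k = b i then w k else 0) = ∑ j, if b' j = b i then w' j else 0) :
    Set.range b ⊆ Set.range b' := by
  classical
  rintro _ ⟨i, rfl⟩
  by_contra h
  have h0 : ∀ j, b' j ≠ b i := fun j hj => h ⟨j, hj⟩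
  have := hmass i
  simp only [hb.eq_iff, h0, Finset.sum_ite_eq', Finset.mem_univ, if_true, if_false,
    Finset.sum_const_zero] at this
  exact (hw i).ne' this


/-- The parameters of a `K`-categorical distribution are uniquely determined by its
moments of order up to `2K - 1`: if two categorical distributions with strictly
increasing support points and strictly positive probabilities summing to one have
the same moments `∑ k, π k * b k ^ r` for every `r = 0, 1, …, 2K − 1`, then they
have the same support points and the same probabilities. -/
theorem categorical_identification
    (K : ℕ) (hK : 1 ≤ K)
    (π π' : Fin K → ℝ) (b b' : Fin K → ℝ)
    (hπpos : ∀ k, 0 < π k) (hπ'pos : ∀ k, 0 < π' k)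
    (hπsum : ∑ k, π k = 1) (hπ'sum : ∑ k, π' k = 1)
    (hb : StrictMono b) (hb' : StrictMono b')
    (hmom : ∀ r : ℕ, r < 2 * K →
      ∑ k, π k * b k ^ r = ∑ k, π' k * b' k ^ r) :
    (∀ k, b k = b' k) ∧ (∀ k, π k = π' k) := by
  classical
  set s : Finset ℝ := Finset.univ.image b ∪ Finset.univ.image b' with hs
  have hcard : s.card ≤ 2 * K := by
    have h₁ : s.card ≤ _ := Finset.card_union_le (Finset.univ.image b) (Finset.univ.image b')
    have h₂ := Finset.card_image_le (s := Finset.univ) (f := b)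
    have h₃ := Finset.card_image_le (s := Finset.univ) (f := b')
    simp only [Finset.card_univ, Fintype.card_fin] at h₂ h₃
    omega
  have hbs : ∀ k, b k ∈ s := fun k => by simp [hs]
  have hbs' : ∀ k, b' k ∈ s := fun k => by simp [hs]
  have hmass {x : ℝ} (hx : x ∈ s) := mass_eq_of_moments_eq hcard hbs hbs' hmom hx
  have hrange : Set.range b = Set.range b' :=
    (range_subset_range_of_mass_eq hπpos hb.injective fun k => hmass (hbs k)).antisymm
      (range_subset_range_of_mass_eq hπ'pos hb'.injective fun k => (hmass (hbs' k)).symm)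
  obtain rfl : b = b' := (StrictMono.range_inj hb hb').mp hrange
  refine ⟨fun _ => rfl, fun k => ?_⟩
  simpa [hb.injective.eq_iff] using hmass (hbs k)
end

section
/- Let π ∈ (0,1) and β_L < β_H be real numbers, and set m_r = π β_L^r + (1−π) β_H^r for r = 1, 2, 3. Define s = (m_3 − m_1 m_2)/(m_2 − m_1²) and p = (m_1 m_3 − m_2²)/(m_2 − m_1²). Then s² − 4p > 0 and the parameters are recovered explicitly from the moments by β_L = (s − √(s² − 4p))/2, β_H = (s + √(s² − 4p))/2, and π = (β_H − m_1)/(β_H − β_L). -/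
/-- Explicit identification of a two-point distribution from its first three moments
`m r = π βL^r + (1-π) βH^r`: with `s = (m₃ - m₁ m₂)/(m₂ - m₁²)` and
`p = (m₁ m₃ - m₂²)/(m₂ - m₁²)`, one has `s² - 4p > 0`,
`βL = (s - √(s² - 4p))/2`, `βH = (s + √(s² - 4p))/2`, and `π = (βH - m₁)/(βH - βL)`. -/
theorem two_point_explicit_identification
    (π βL βH : ℝ) (hπ0 : 0 < π) (hπ1 : π < 1) (hβ : βL < βH)
    (m₁ m₂ m₃ : ℝ)
    (hm₁ : m₁ = π * βL + (1 - π) * βH)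
    (hm₂ : m₂ = π * βL ^ 2 + (1 - π) * βH ^ 2)
    (hm₃ : m₃ = π * βL ^ 3 + (1 - π) * βH ^ 3)
    (s p : ℝ)
    (hs : s = (m₃ - m₁ * m₂) / (m₂ - m₁ ^ 2))
    (hp : p = (m₁ * m₃ - m₂ ^ 2) / (m₂ - m₁ ^ 2)) :
    0 < s ^ 2 - 4 * p ∧
    βL = (s - Real.sqrt (s ^ 2 - 4 * p)) / 2 ∧
    βH = (s + Real.sqrt (s ^ 2 - 4 * p)) / 2 ∧
    π = (βH - m₁) / (βH - βL) := by
  have hgap : 0 < βH - βL := sub_pos.mpr hβ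
  have hvar : m₂ - m₁ ^ 2 = π * (1 - π) * (βH - βL) ^ 2 := by
    rw [hm₁, hm₂]; ring
  have hvar_ne : m₂ - m₁ ^ 2 ≠ 0 := by
    rw [hvar]
    exact (mul_pos (mul_pos hπ0 (sub_pos.mpr hπ1)) (pow_pos hgap 2)).ne'
  have hsum : s = βL + βH := by
    rw [hs, div_eq_iff hvar_ne, hvar, hm₁, hm₂, hm₃]; ring
  have hprod : p = βL * βH := by
    rw [hp, div_eq_iff hvar_ne, hvar, hm₁, hm₂, hm₃]; ring
  have hdisc : s ^ 2 - 4 * p = (βH - βL) ^ 2 := by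
    rw [hsum, hprod]; ring
  rw [hdisc, Real.sqrt_sq hgap.le, hsum]
  refine ⟨pow_pos hgap 2, by ring, by ring, ?_⟩
  rw [eq_div_iff hgap.ne', hm₁]; ring
end

section
/- Fix an integer R ≥ 1 and real numbers ρ_{0,s} for s = 1,…,2R and ρ_{r,0}, ρ_{r,r} for r = 2,…,R, such that ρ_{0,2r} − ρ_{0,r}² > 0 for every r = 2,…,R. Suppose (a_r)_{r=0}^{R}, (s_r)_{r=0}^{R} and (a'_r)_{r=0}^{R}, (s'_r)_{r=0}^{R} are real sequences with a_0 = a'_0 = 1, a_1 = a'_1, s_0 = s'_0 = 1, s_1 = s'_1 = 0, and suppose both pairs of sequences satisfy, for every r = 2,…,R, the two equations ρ_{0,r} a_r + s_r = ρ_{r,0} − Σ_{q=2}^{r−1} C(r,q) ρ_{0,r−q} s_q a_{r−q} and ρ_{0,2r} a_r + ρ_{0,r} s_r = ρ_{r,r} − Σ_{q=2}^{r−1} C(r,q) ρ_{0,2r−q} s_q a_{r−q}. Then a_r = a'_r and s_r = s'_r for all r = 0,…,R. -/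
/-- A 2×2 linear system with rows `(p, 1)` and `(d, p)` and `d - p ^ 2 > 0` has at most one
solution. -/
theorem eq_and_eq_of_linear_system {p d x y x' y' : ℝ} (hd : 0 < d - p ^ 2)
    (h₁ : p * x + y = p * x' + y') (h₂ : d * x + p * y = d * x' + p * y') :
    x = x' ∧ y = y' := by
  have hx : x = x' := mul_left_cancel₀ hd.ne' (by linear_combination h₂ - p * h₁)
  subst hx
  exact ⟨rfl, add_left_cancel h₁⟩

/-- Identification of the moments in Theorem 1 of the paper: the triangular system of
equations (eq:mc_limit_r)/(eq:mc_limit_2r) determines the sequences `(a_r)` (moments of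
the random coefficient) and `(s_r)` (limiting error moments) uniquely, provided
`ρ_{0,2r} - ρ_{0,r}² > 0` for `r = 2,…,R` (invertibility of the 2×2 coefficient
matrices). -/
theorem moment_system_unique_solution
    (R : ℕ) (hR : 1 ≤ R)
    (ρ0 ρr0 ρrr : ℕ → ℝ)
    (hpos : ∀ r : ℕ, 2 ≤ r → r ≤ R → 0 < ρ0 (2 * r) - (ρ0 r) ^ 2)
    (a s a' s' : ℕ → ℝ)
    (ha0 : a 0 = 1) (ha0' : a' 0 = 1) (ha1 : a 1 = a' 1)
    (hs0 : s 0 = 1) (hs0' : s' 0 = 1) (hs1 : s 1 = 0) (hs1' : s' 1 = 0)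
    (heq1 : ∀ r : ℕ, 2 ≤ r → r ≤ R →
      ρ0 r * a r + s r
        = ρr0 r - ∑ q ∈ Finset.Icc 2 (r - 1),
            (r.choose q : ℝ) * ρ0 (r - q) * s q * a (r - q))
    (heq2 : ∀ r : ℕ, 2 ≤ r → r ≤ R →
      ρ0 (2 * r) * a r + ρ0 r * s r
        = ρrr r - ∑ q ∈ Finset.Icc 2 (r - 1),
            (r.choose q : ℝ) * ρ0 (2 * r - q) * s q * a (r - q))
    (heq1' : ∀ r : ℕ, 2 ≤ r → r ≤ R →
      ρ0 r * a' r + s' r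
        = ρr0 r - ∑ q ∈ Finset.Icc 2 (r - 1),
            (r.choose q : ℝ) * ρ0 (r - q) * s' q * a' (r - q))
    (heq2' : ∀ r : ℕ, 2 ≤ r → r ≤ R →
      ρ0 (2 * r) * a' r + ρ0 r * s' r
        = ρrr r - ∑ q ∈ Finset.Icc 2 (r - 1),
            (r.choose q : ℝ) * ρ0 (2 * r - q) * s' q * a' (r - q)) :
    ∀ r : ℕ, r ≤ R → a r = a' r ∧ s r = s' r := by
  intro r
  induction r using Nat.strong_induction_on with
  | _ r ih =>
    intro hr
    obtain rfl | rfl | h2 : r = 0 ∨ r = 1 ∨ 2 ≤ r := by omega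
    · exact ⟨ha0.trans ha0'.symm, hs0.trans hs0'.symm⟩
    · exact ⟨ha1, hs1.trans hs1'.symm⟩
    · have hsum (c : ℕ → ℝ) : ∑ q ∈ Finset.Icc 2 (r - 1), c q * s q * a (r - q)
          = ∑ q ∈ Finset.Icc 2 (r - 1), c q * s' q * a' (r - q) := by
        refine Finset.sum_congr rfl fun q hq => ?_
        rw [Finset.mem_Icc] at hq
        rw [(ih q (by omega) (by omega)).2, (ih (r - q) (by omega) (by omega)).1]
      refine eq_and_eq_of_linear_system (hpos r h2 hr) ?_ ?_
      · rw [heq1 r h2 hr, heq1' r h2 hr, hsum fun q => (r.choose q : ℝ) * ρ0 (r - q)]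
      · rw [heq2 r h2 hr, heq2' r h2 hr, hsum fun q => (r.choose q : ℝ) * ρ0 (2 * r - q)]
end
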